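/- Let w : [0,T) → ℝ^N with T ∈ (0,∞] be a regular reparametrized gradient flow under Assumptions (B1), (A2), (A3), (B2), with D_rp unbounded, and let F(z̃) = ⟨1, H(z̃)⟩ with D_F the associated Bregman divergence. If every Bregman ball B_{D_F,r}(x) = {z ∈ D_rp^N : D_F(x, z) ≤ r} (x ∈ D_rp^N, r ≥ 0) is bounded with respect to the Euclidean norm, then sup_{t ∈ [0,T)} ‖w̃(t)‖₂ < ∞. -/

import Mathlib

open Filter Topology Set
open scoped ENNReal

noncomputable section

/-- Euclidean gradient of `f : ℝ^k → ℝ`: coordinatewise the Fréchet derivative applied to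
the standard basis vectors. -/
def grad {k : ℕ} (f : (Fin k → ℝ) → ℝ) (x : Fin k → ℝ) : Fin k → ℝ :=
  fun i => fderiv ℝ f x (Pi.single i 1)

/-- `w` solves the gradient-flow ODE `w' = -∇F(w)` on `[0, T)`, where `T ∈ (0, ∞]` is coded
as an element of `ℝ≥0∞`. -/
def IsGradFlowOn {k : ℕ} (F : (Fin k → ℝ) → ℝ) (T : ℝ≥0∞) (w : ℝ → Fin k → ℝ) : Prop :=
  ∀ t : ℝ, 0 ≤ t → ENNReal.ofReal t < T →
    HasDerivWithinAt w (-(grad F (w t))) (Set.Ici 0) t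

/-- A reparametrized flow is regular if `ρ'` vanishes at some coordinate of `w t` for only
finitely many times `t` in the domain `[0, T)`. -/
def RegularFlow {k : ℕ} (ρ : ℝ → ℝ) (T : ℝ≥0∞) (w : ℝ → Fin k → ℝ) : Prop :=
  {t : ℝ | 0 ≤ t ∧ ENNReal.ofReal t < T ∧ ∃ i, deriv ρ (w t i) = 0}.Finite

/-- The filter of "`t → T` from within `[0,T)`", with `T = ∞` meaning `t → ∞`. -/
def endFilter (T : ℝ≥0∞) : Filter ℝ :=
  if T = ⊤ then Filter.atTop else nhdsWithin T.toReal (Set.Iio T.toReal)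

/-- Entrywise ℓp-norm on `ℝ^k`. -/
def lpNorm {k : ℕ} (p : ℝ) (z : Fin k → ℝ) : ℝ := (∑ i, |z i| ^ p) ^ (1 / p)

/-- Euclidean norm on `ℝ^k`. -/
def euclNorm {k : ℕ} (z : Fin k → ℝ) : ℝ := Real.sqrt (∑ i, (z i) ^ 2)

/-- Bregman divergence associated with `F(z) = ∑ i, H (z i)`, whose gradient is `h = H'`
applied entrywise. -/
def bregman {k : ℕ} (H h : ℝ → ℝ) (p q : Fin k → ℝ) : ℝ :=
  (∑ i, H (p i)) - (∑ i, H (q i)) - ∑ i, h (q i) * (p i - q i)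

/-- Assumption (A3) on the loss function: continuously differentiable, convex in the first
argument, with minimum `0` attained exactly on the diagonal. -/
structure LossA3 {m : ℕ} (L : (Fin m → ℝ) → (Fin m → ℝ) → ℝ) : Prop where
  contDiff : ContDiff ℝ 1 (Function.uncurry L)
  convexOn_fst : ∀ y, ConvexOn ℝ Set.univ fun z => L z y
  nonneg : ∀ z z', 0 ≤ L z z'
  eq_zero_iff : ∀ z z', L z z' = 0 ↔ z = z'

/-- Assumption (A1) on the link function. -/
structure LinkA1 {m : ℕ} (ρlink : ℝ → ℝ) (y : Fin m → ℝ) : Prop where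
  contDiff : ContDiff ℝ 1 ρlink
  injective : Function.Injective ρlink
  mem_image : ∀ j, ∃ x : ℝ, ρlink x = y j

/-- Assumption (A2) on the reparametrization `ρ : ℝ → D` with inverse `ρinv`:
continuously differentiable and invertible, derivative nonzero outside a finite set, and
`([ρ⁻¹]')²` integrable on every compact subset of `D`. -/
structure RepA2 (ρ : ℝ → ℝ) (D : Set ℝ) (ρinv : ℝ → ℝ) : Prop where
  contDiff : ContDiff ℝ 1 ρ
  mapsTo : ∀ x : ℝ, ρ x ∈ D
  left_inv : ∀ x : ℝ, ρinv (ρ x) = x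
  right_inv : ∀ z ∈ D, ρ (ρinv z) = z
  finite_critical : {x : ℝ | deriv ρ x = 0}.Finite
  loc_integrable : ∀ C : Set ℝ, C ⊆ D → IsCompact C →
    MeasureTheory.IntegrableOn (fun z => (deriv ρinv z) ^ 2) C

/-- A function continuous on `[a, b]` whose derivative is nonpositive outside a finite set
does not increase from `a` to `b`. -/
lemma le_of_hasDerivAt_nonpos_off_finite {f : ℝ → ℝ} {s : Set ℝ} (hs : s.Finite) {a b : ℝ}
    (hab : a ≤ b) (hf : ContinuousOn f (Icc a b))
    (hd : ∀ x ∈ Ioo a b, x ∉ s → ∃ f', HasDerivAt f f' x ∧ f' ≤ 0) : f b ≤ f a := by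
  induction s, hs using Set.Finite.induction_on generalizing a b with
  | empty =>
    refine antitoneOn_of_deriv_nonpos (convex_Icc a b) hf ?_ ?_ (left_mem_Icc.2 hab)
      (right_mem_Icc.2 hab) hab
    · rw [interior_Icc]
      intro x hx
      obtain ⟨f', h1, -⟩ := hd x hx (notMem_empty x)
      exact h1.differentiableAt.differentiableWithinAt
    · rw [interior_Icc]
      intro x hx
      obtain ⟨f', h1, h2⟩ := hd x hx (notMem_empty x)
      rwa [h1.deriv]
  | @insert c s _ _ ih =>
    by_cases hc : c ∈ Ioo a b
    · refine (ih hc.2.le (hf.mono (Icc_subset_Icc_left hc.1.le)) fun x hx hxs =>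
        hd x ⟨hc.1.trans hx.1, hx.2⟩ ?_).trans
        (ih hc.1.le (hf.mono (Icc_subset_Icc_right hc.2.le)) fun x hx hxs =>
        hd x ⟨hx.1, hx.2.trans hc.2⟩ ?_)
      · simp [hxs, hx.1.ne']
      · simp [hxs, hx.2.ne]
    · refine ih hab hf fun x hx hxs => hd x hx ?_
      rintro (rfl | h)
      exacts [hc hx, hxs h]

/-- A function continuous at `x` whose derivative near `x`, except at `x`, is given by a function
continuous at `x` is differentiable at `x`. -/
lemma hasDerivAt_of_eventually_hasDerivAt {f g : ℝ → ℝ} {x : ℝ}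
    (hd : ∀ᶠ y in 𝓝[≠] x, HasDerivAt f (g y) y) (hf : ContinuousAt f x)
    (hg : ContinuousAt g x) : HasDerivAt f (g x) x := by
  have hr : ∀ᶠ y in 𝓝[>] x, HasDerivAt f (g y) y :=
    hd.filter_mono (nhdsWithin_mono x fun y hy => ne_of_gt hy)
  have hl : ∀ᶠ y in 𝓝[<] x, HasDerivAt f (g y) y :=
    hd.filter_mono (nhdsWithin_mono x fun y hy => ne_of_lt hy)
  have A : HasDerivWithinAt f (g x) (Ici x) x :=
    hasDerivWithinAt_Ici_of_tendsto_deriv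
      (fun y hy => (HasDerivAt.differentiableAt hy).differentiableWithinAt)
      hf.continuousWithinAt hr
      ((tendsto_inf_left hg).congr' (hr.mono fun y hy => hy.deriv.symm))
  have B : HasDerivWithinAt f (g x) (Iic x) x :=
    hasDerivWithinAt_Iic_of_tendsto_deriv
      (fun y hy => (HasDerivAt.differentiableAt hy).differentiableWithinAt)
      hf.continuousWithinAt hl
      ((tendsto_inf_left hg).congr' (hl.mono fun y hy => hy.deriv.symm))
  simpa using B.union A

/-- First-order lower bound for a differentiable convex function. -/
lemma ConvexOn.fderiv_sub_le {E : Type*} [NormedAddCommGroup E] [NormedSpace ℝ E] {f : E → ℝ}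
    (hf : ConvexOn ℝ univ f) {u : E} (hd : DifferentiableAt ℝ f u) (v : E) :
    fderiv ℝ f u (v - u) ≤ f v - f u := by
  have hc : ConvexOn ℝ univ (f ∘ AffineMap.lineMap (k := ℝ) u v) := by
    simpa using hf.comp_affineMap (AffineMap.lineMap (k := ℝ) u v)
  have hl : HasDerivAt (f ∘ AffineMap.lineMap (k := ℝ) u v) (fderiv ℝ f u (v - u)) 0 :=
    HasFDerivAt.comp_hasDerivAt_of_eq 0 hd.hasFDerivAt AffineMap.hasDerivAt_lineMap (by simp)
  simpa [slope_def_field] using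
    hc.le_slope_of_hasDerivAt (mem_univ 0) (mem_univ 1) zero_lt_one hl

namespace RepA2

variable {ρ ρinv : ℝ → ℝ} {D : Set ℝ}

lemma hasStrictDerivAt (hA2 : RepA2 ρ D ρinv) (x : ℝ) : HasStrictDerivAt ρ (deriv ρ x) x :=
  hA2.contDiff.contDiffAt.hasStrictDerivAt one_ne_zero

/-- A potential whose derivative is `([ρ⁻¹]')²` off a finite set satisfies `(h ∘ ρ)' = 1 / ρ'`
at every noncritical point of `ρ`. -/
lemma hasDerivAt_potential_comp (hA2 : RepA2 ρ D ρinv) {h : ℝ → ℝ} {S : Set ℝ} (hS : S.Finite)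
    (hcont : ContinuousOn h D)
    (hderiv : ∀ z ∈ D \ S, HasDerivWithinAt h ((deriv ρinv z) ^ 2) D z)
    {x : ℝ} (hx : deriv ρ x ≠ 0) : HasDerivAt (fun u => h (ρ u)) (deriv ρ x)⁻¹ x := by
  have hρ' : Continuous (deriv ρ) := hA2.contDiff.continuous_deriv le_rfl
  have hinj : Function.Injective ρ := Function.LeftInverse.injective hA2.left_inv
  refine hasDerivAt_of_eventually_hasDerivAt (g := fun u => (deriv ρ u)⁻¹) ?_
    (hcont.comp_continuous hA2.contDiff.continuous hA2.mapsTo).continuousAt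
    (hρ'.continuousAt.inv₀ hx)
  have hfin : (ρ ⁻¹' S).Finite := hS.preimage hinj.injOn
  have hS' : ∀ᶠ u in 𝓝[≠] x, u ∉ ρ ⁻¹' S := by
    filter_upwards [self_mem_nhdsWithin, nhdsWithin_le_nhds
      ((hfin.sdiff (t := {x})).isClosed.compl_mem_nhds fun hx => hx.2 rfl)] with u hne hu hus
    exact hu ⟨hus, hne⟩
  filter_upwards [hS', nhdsWithin_le_nhds (hρ'.continuousAt.eventually_ne hx)] with u hu hu'
  have hinv : HasDerivAt ρinv (deriv ρ u)⁻¹ (ρ u) :=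
    ((hA2.hasStrictDerivAt u).to_local_left_inverse hu'
      (Eventually.of_forall hA2.left_inv)).hasDerivAt
  have := (hderiv (ρ u) ⟨hA2.mapsTo u, hu⟩).comp_hasDerivAt u
    (hA2.hasStrictDerivAt u).hasDerivAt (Eventually.of_forall hA2.mapsTo)
  rw [hinv.deriv] at this
  refine this.congr_deriv ?_
  field_simp

/-- Derivative of the one-dimensional Bregman divergence of `H` in the parameter of its second
argument. -/
lemma hasDerivAt_bregman_summand (hA2 : RepA2 ρ D ρinv) {h H : ℝ → ℝ} {S : Set ℝ} (hS : S.Finite)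
    (hcont : ContinuousOn h D)
    (hderiv : ∀ z ∈ D \ S, HasDerivWithinAt h ((deriv ρinv z) ^ 2) D z)
    (hHderiv : ∀ z ∈ D, HasDerivWithinAt H (h z) D z) (p : ℝ)
    {x : ℝ} (hx : deriv ρ x ≠ 0) :
    HasDerivAt (fun u => H p - H (ρ u) - h (ρ u) * (p - ρ u))
      (-((deriv ρ x)⁻¹ * (p - ρ x))) x := by
  have hρ := (hA2.hasStrictDerivAt x).hasDerivAt
  have h1 := (hHderiv (ρ x) (hA2.mapsTo x)).comp_hasDerivAt x hρ (Eventually.of_forall hA2.mapsTo)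
  have h2 := hA2.hasDerivAt_potential_comp hS hcont hderiv hx
  refine ((h1.const_sub (H p)).sub (h2.mul (hρ.const_sub p))).congr_deriv ?_
  ring

end RepA2

lemma bregman_eq_sum {k : ℕ} (H h : ℝ → ℝ) (p q : Fin k → ℝ) :
    bregman H h p q = ∑ i, (H (p i) - H (q i) - h (q i) * (p i - q i)) := by
  simp [bregman, Finset.sum_sub_distrib]

/-- Chain rule for the gradient of a function of `A ρ(z)`. -/
lemma grad_comp_mulVec {N M : ℕ} {ρ : ℝ → ℝ} (hρ : Differentiable ℝ ρ)
    (A : Matrix (Fin M) (Fin N) ℝ) {f : (Fin M → ℝ) → ℝ} (hf : Differentiable ℝ f)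
    (z : Fin N → ℝ) (i : Fin N) :
    grad (fun z => f (A.mulVec fun j => ρ (z j))) z i =
      deriv ρ (z i) * fderiv ℝ f (A.mulVec fun j => ρ (z j)) (A.mulVec (Pi.single i 1)) := by
  let B : (Fin N → ℝ) →L[ℝ] (Fin M → ℝ) := A.mulVecLin.toContinuousLinearMap
  have h1 : HasFDerivAt (fun (z : Fin N → ℝ) j => ρ (z j))
      (ContinuousLinearMap.pi fun j =>
        deriv ρ (z j) • (ContinuousLinearMap.proj j : (Fin N → ℝ) →L[ℝ] ℝ)) z :=
    hasFDerivAt_pi.2 fun j =>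
      (hρ (z j)).hasDerivAt.comp_hasFDerivAt z (hasFDerivAt_apply j z)
  have h2 := (hf (B fun j => ρ (z j))).hasFDerivAt.comp z (B.hasFDerivAt.comp z h1)
  have h3 : (fun j => deriv ρ (z j) * (Pi.single i 1 : Fin N → ℝ) j) =
      deriv ρ (z i) • (Pi.single i 1 : Fin N → ℝ) := by
    ext j
    rcases eq_or_ne j i with rfl | hj <;> simp [*]
  have h4 : B (fun j => deriv ρ (z j) * (Pi.single i 1 : Fin N → ℝ) j) =
      deriv ρ (z i) • A.mulVec (Pi.single i 1) := by
    rw [h3, map_smul]; rfl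
  have h5 : grad (fun z => f (A.mulVec fun j => ρ (z j))) z i =
      fderiv ℝ f (B fun j => ρ (z j))
        (B (fun j => deriv ρ (z j) * (Pi.single i 1 : Fin N → ℝ) j)) :=
    congrArg (fun l : (Fin N → ℝ) →L[ℝ] ℝ => l (Pi.single i 1)) h2.fderiv
  rw [h5, h4, map_smul, smul_eq_mul]
  rfl

/-- If all Bregman balls are bounded, the reparametrized trajectory is
bounded. -/
theorem statement10 {N M : ℕ} (ρ ρinv : ℝ → ℝ) (D : Set ℝ) (hA2 : RepA2 ρ D ρinv)
    (hDunbdd : ¬ Bornology.IsBounded D)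
    (A : Matrix (Fin M) (Fin N) ℝ) (y : Fin M → ℝ)
    (L : (Fin M → ℝ) → (Fin M → ℝ) → ℝ) (hA3 : LossA3 L)
    (zt0 : Fin N → ℝ) (hzt0mem : ∀ i, zt0 i ∈ D) (hzt0 : A.mulVec zt0 = y)
    (h H : ℝ → ℝ) (S : Set ℝ) (hS : S.Finite)
    (hcont : ContinuousOn h D) (hHcont : ContinuousOn H D)
    (hderiv : ∀ z ∈ D \ S, HasDerivWithinAt h ((deriv ρinv z) ^ 2) D z)
    (hHderiv : ∀ z ∈ D, HasDerivWithinAt H (h z) D z)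
    (T : ℝ≥0∞) (hT : 0 < T) (w : ℝ → Fin N → ℝ)
    (hflow : IsGradFlowOn (fun z => L (A.mulVec fun i => ρ (z i)) y) T w)
    (hreg : RegularFlow ρ T w)
    (hballs : ∀ x : Fin N → ℝ, (∀ i, x i ∈ D) → ∀ r : ℝ, 0 ≤ r →
      ∃ C : ℝ, ∀ z : Fin N → ℝ, (∀ i, z i ∈ D) → bregman H h x z ≤ r → euclNorm z ≤ C) :
    ∃ C : ℝ, ∀ t : ℝ, 0 ≤ t → ENNReal.ofReal t < T →
      euclNorm (fun i => ρ (w t i)) ≤ C := by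
  have hρc : Continuous ρ := hA2.contDiff.continuous
  have hρd : Differentiable ℝ ρ := hA2.contDiff.differentiable one_ne_zero
  have hLd : Differentiable ℝ fun z => L z y :=
    (hA3.contDiff.differentiable one_ne_zero).comp
      (differentiable_id.prodMk (differentiable_const y))
  let G : ℝ → ℝ := fun t => bregman H h zt0 fun i => ρ (w t i)
  have hGsum : G = fun t => ∑ i, (H (zt0 i) - H (ρ (w t i)) -
      h (ρ (w t i)) * (zt0 i - ρ (w t i))) := funext fun t => bregman_eq_sum H h _ _
  have hHρ : Continuous fun u => H (ρ u) := hHcont.comp_continuous hρc hA2.mapsTo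
  have hhρ : Continuous fun u => h (ρ u) := hcont.comp_continuous hρc hA2.mapsTo
  have hGle : ∀ t : ℝ, 0 ≤ t → ENNReal.ofReal t < T → G t ≤ G 0 := by
    intro t ht htT
    have hdom : ∀ s ≤ t, ENNReal.ofReal s < T := fun s hs =>
      (ENNReal.ofReal_le_ofReal hs).trans_lt htT
    refine le_of_hasDerivAt_nonpos_off_finite hreg ht ?_ ?_
    · have hw : ContinuousOn w (Icc 0 t) := fun s hs =>
        (hflow s hs.1 (hdom s hs.2)).continuousWithinAt.mono Icc_subset_Ici_self
      rw [hGsum]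
      refine continuousOn_finsetSum _ fun i _ => ?_
      have hφ : Continuous fun u => H (zt0 i) - H (ρ u) - h (ρ u) * (zt0 i - ρ u) :=
        (continuous_const.sub hHρ).sub (hhρ.mul (continuous_const.sub hρc))
      exact hφ.comp_continuousOn ((continuous_apply i).comp_continuousOn hw)
    · intro s hs hcrit
      have hne : ∀ i, deriv ρ (w s i) ≠ 0 := fun i hi =>
        hcrit ⟨hs.1.le, hdom s hs.2.le, i, hi⟩
      have hw := hasDerivAt_pi.1 ((hflow s hs.1.le (hdom s hs.2.le)).hasDerivAt (Ici_mem_nhds hs.1))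
      let q : Fin N → ℝ := fun i => ρ (w s i)
      refine ⟨fderiv ℝ (fun z => L z y) (A.mulVec q) (y - A.mulVec q), ?_, ?_⟩
      · rw [hGsum]
        refine (HasDerivAt.fun_sum fun i _ =>
          (hA2.hasDerivAt_bregman_summand hS hcont hderiv hHderiv (zt0 i) (hne i)).comp s
            (hw i)).congr_deriv ?_
        have hlin : y - A.mulVec q = ∑ i, (zt0 i - q i) • A.mulVec (Pi.single i 1) := by
          rw [← hzt0, ← Matrix.mulVec_sub]
          conv_lhs => rw [pi_eq_sum_univ' (zt0 - q)]
          simp [Matrix.mulVec_sum, Matrix.mulVec_smul]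
        rw [hlin, map_sum]
        refine Finset.sum_congr rfl fun i _ => ?_
        rw [Pi.neg_apply, grad_comp_mulVec hρd A hLd, map_smul, smul_eq_mul]
        have := hne i
        field_simp
        rfl
      · have := (hA3.convexOn_fst y).fderiv_sub_le (hLd (A.mulVec q)) y
        have h0 := (hA3.eq_zero_iff y y).2 rfl
        have h1 := hA3.nonneg (A.mulVec q) y
        simp only [h0] at this
        linarith
  obtain ⟨C, hC⟩ := hballs zt0 hzt0mem (max (G 0) 0) (le_max_right _ _)
  exact ⟨C, fun t ht htT => hC _ (fun i => hA2.mapsTo _)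
    ((hGle t ht htT).trans (le_max_left _ _))⟩
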